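/- Let d ≥ 6 be squarefree with d ≡ 3 (mod 4), F = ℚ(√d), and write the fundamental unit as ε = a + b√d with positive integers a, b (note O_F = ℤ[√d] and Nm_{F/ℚ}(ε) = 1 here). Let L = F(√−ε) and let 𝔭 be the unique prime of O_F above 2. If a is even, then L/F is ramified at 𝔭 and the ring of integers of L equals O_F[√−ε] = O_F ⊕ O_F·√−ε; if a is odd, then L/F is unramified at every finite prime of F. -/

import Mathlib

open NumberField Quaternion

noncomputable section

namespace QuatPaper

variable (F : Type) [Field F] [NumberField F]

def scalarSet (H : Type) [Ring H] [Algebra F H] : Set H :=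
  Set.range fun r : 𝓞 F => algebraMap F H (algebraMap (𝓞 F) F r)

def IsOrder {H : Type} [Ring H] [Algebra F H] (O : Subring H) : Prop :=
  scalarSet F H ⊆ ↑O ∧ O.toAddSubgroup.FG ∧ Submodule.span F (O : Set H) = ⊤

def IsMaximalOrder {H : Type} [Ring H] [Algebra F H] (O : Subring H) : Prop :=
  IsOrder F O ∧ ∀ O' : Subring H, IsOrder F O' → O ≤ O' → O' = O

def IsScalarUnit {H : Type} [Ring H] [Algebra F H] {O : Subring H} (u : (↥O)ˣ) : Prop :=
  ∃ r : (𝓞 F)ˣ, ((u : ↥O) : H) = algebraMap F H (algebraMap (𝓞 F) F ↑r)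

def RedUnitIso {H : Type} [Ring H] [Algebra F H] (O : Subring H) (G : Type*) [Group G] : Prop :=
  ∃ φ : (↥O)ˣ →* G, Function.Surjective φ ∧ ∀ u, φ u = 1 ↔ IsScalarUnit F u

def IsConjugate {H : Type} [Ring H] (x : Hˣ) (O O' : Subring H) : Prop :=
  ∀ y : H, y ∈ O ↔ (x : H) * y * ((x⁻¹ : Hˣ) : H) ∈ O'

def ConjRel {H : Type} [Ring H] (O O' : Subring H) : Prop :=
  ∃ x : Hˣ, IsConjugate x O O'

def typeNum (H : Type) [Ring H] [Algebra F H] (G : Type*) [Group G] : ℕ :=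
  Nat.card (Quot fun O O' : {O : Subring H // IsMaximalOrder F O ∧ RedUnitIso F O G} =>
    ConjRel O.1 O'.1)

def IsQuatAlg (H : Type) [Ring H] [Algebra F H] : Prop :=
  ∃ a b : F, a ≠ 0 ∧ b ≠ 0 ∧ Nonempty (H ≃ₐ[F] ℍ[F, a, b])

def TotallyDefinite (H : Type) [Ring H] [Algebra F H] : Prop :=
  ∀ σ : F →+* ℝ,
    letI : Algebra F ℝ := σ.toAlgebra
    ∀ x : TensorProduct F ℝ H, x ≠ 0 → IsUnit x

theorem exists_eq_add_mul_of_adjoin_eq_top {k K : Type*} [Field k] [Field K] [Algebra k K]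
    {s : K} {c : k} (hs : s ^ 2 = algebraMap k K c) (hgen : Algebra.adjoin k {s} = ⊤) (x : K) :
    ∃ u v : k, x = algebraMap k K u + algebraMap k K v * s := by
  have hx : x ∈ Algebra.adjoin k {s} := hgen ▸ Algebra.mem_top
  induction hx using Algebra.adjoin_induction with
  | mem y hy => exact ⟨0, 1, by simpa using hy⟩
  | algebraMap y => exact ⟨y, 0, by simp⟩
  | add y z _ _ hy hz =>
    obtain ⟨u, v, rfl⟩ := hy
    obtain ⟨u', v', rfl⟩ := hz
    exact ⟨u + u', v + v', by simp only [map_add]; ring⟩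
  | mul y z _ _ hy hz =>
    obtain ⟨u, v, rfl⟩ := hy
    obtain ⟨u', v', rfl⟩ := hz
    refine ⟨u * u' + v * v' * c, u * v' + v * u', ?_⟩
    simp only [map_add, map_mul, ← hs]
    ring

open Polynomial in
theorem exists_trace_norm_of_isIntegral (R : Type*) {k K : Type*} [CommRing R] [IsDomain R]
    [IsIntegrallyClosed R] [Field k] [Field K] [Algebra R k] [IsFractionRing R k] [Algebra k K]
    [Algebra R K] [IsScalarTower R k K] {s : K} {c : k} (hs : s ^ 2 = algebraMap k K c)
    (hc : ¬ IsSquare c) {u v : k} (hx : IsIntegral R (algebraMap k K u + algebraMap k K v * s)) :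
    ∃ T N : R, algebraMap R k T = 2 * u ∧ algebraMap R k N = u ^ 2 - c * v ^ 2 := by
  by_cases hv : v = 0
  · subst hv
    have hu : IsIntegral R u := by
      simpa [isIntegral_algebraMap_iff (algebraMap k K).injective] using hx
    obtain ⟨U, rfl⟩ := IsIntegrallyClosed.isIntegral_iff.mp hu
    exact ⟨2 * U, U ^ 2, by rw [map_mul, map_ofNat], by simp⟩
  · set x := algebraMap k K u + algebraMap k K v * s with hxdef
    have hv' : algebraMap k K v ≠ 0 := by simpa using hv
    have hxk : x ∉ (algebraMap k K).range := by
      rintro ⟨y, hy⟩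
      refine hc ⟨(y - u) / v, (algebraMap k K).injective ?_⟩
      rw [← hs]
      simp only [map_mul, map_div₀, map_sub]
      field_simp
      rw [hy, hxdef]
      ring
    set f : k[X] := X ^ 2 + (C (-(2 * u)) * X + C (u ^ 2 - c * v ^ 2)) with hf
    have hfm : f.Monic := by
      rw [hf]; monicity!
    have hfd : f.natDegree = 2 := by
      rw [hf]; compute_degree!
    have hroot : aeval x f = 0 := by
      simp only [hf, map_add, map_mul, map_pow, aeval_X, aeval_C, map_neg, map_sub, hxdef, ← hs,
        map_ofNat]
      ring
    have hint : IsIntegral k x := hx.tower_top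
    have hmin : minpoly k x = f := by
      refine (Polynomial.eq_of_monic_of_dvd_of_natDegree_le (minpoly.monic hint) hfm
        (minpoly.dvd k x hroot) ?_).symm
      rw [hfd]
      exact (minpoly.two_le_natDegree_iff hint).mpr hxk
    have hR := minpoly.isIntegrallyClosed_eq_field_fractions' k hx
    rw [hmin] at hR
    refine ⟨-(minpoly R x).coeff 1, (minpoly R x).coeff 0, ?_, ?_⟩
    · rw [map_neg, ← coeff_map, ← hR]
      simp [hf, coeff_X_pow, coeff_C, -map_sub, -map_neg, -map_mul]
    · rw [← coeff_map, ← hR]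
      simp [hf, -map_sub]

theorem exists_int_of_sq_mul_squarefree {d : ℕ} (hd : Squarefree d) {w : ℚ} {M : ℤ}
    (h : w ^ 2 * d = M) : ∃ n : ℤ, w = n := by
  have hden : (w.den : ℚ) ≠ 0 := by simp
  have h1 : w.num ^ 2 * d = M * (w.den : ℤ) ^ 2 := by
    have : (w.num : ℚ) ^ 2 * d = M * (w.den : ℚ) ^ 2 := by
      rw [← h, ← Rat.mul_den_eq_num w]; ring
    exact_mod_cast this
  have h2 : w.num.natAbs ^ 2 * d = M.natAbs * w.den ^ 2 := by
    simpa [Int.natAbs_mul, Int.natAbs_pow] using congrArg Int.natAbs h1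
  have h3 : w.den ^ 2 ∣ d :=
    (w.reduced.symm.pow 2 2).dvd_of_dvd_mul_left ⟨M.natAbs, by rw [h2, mul_comm]⟩
  have h4 : w.den = 1 := by simpa using hd w.den (by rwa [← sq])
  exact ⟨w.num, (Rat.coe_int_num_of_den_eq_one h4).symm⟩

theorem eq_of_squarefree_mul_sq {m n x y : ℕ} (hm : Squarefree m) (hn : Squarefree n)
    (hx : x ≠ 0) (h : m * x ^ 2 = n * y ^ 2) : m = n := by
  obtain ⟨x', y', hco, hx', hy'⟩ := Nat.exists_coprime x y
  have hg : x.gcd y ≠ 0 := fun h0 => hx (Nat.gcd_eq_zero_iff.mp h0).1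
  have h' : m * x' ^ 2 = n * y' ^ 2 := by
    have : (m * x' ^ 2) * (x.gcd y) ^ 2 = (n * y' ^ 2) * (x.gcd y) ^ 2 := by
      calc _ = m * (x' * x.gcd y) ^ 2 := by ring
        _ = n * (y' * x.gcd y) ^ 2 := by rw [← hx', ← hy', h]
        _ = _ := by ring
    exact Nat.eq_of_mul_eq_mul_right (by positivity) this
  have h1 : x' = 1 := by
    have : x' ^ 2 ∣ n := (hco.pow 2 2).dvd_of_dvd_mul_right ⟨m, by rw [← h', mul_comm]⟩
    simpa using hn x' (by rwa [← sq])
  have h2 : y' = 1 := by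
    have : y' ^ 2 ∣ m := (hco.symm.pow 2 2).dvd_of_dvd_mul_right ⟨n, by rw [h', mul_comm]⟩
    simpa using hm y' (by rwa [← sq])
  simpa [h1, h2] using h'

theorem not_isSquare_of_mod_four_eq_three {d : ℕ} (hd : d % 4 = 3) : ¬ IsSquare d := by
  rintro ⟨n, rfl⟩
  have : n % 4 < 4 := Nat.mod_lt _ (by norm_num)
  rw [Nat.mul_mod] at hd
  interval_cases n % 4 <;> simp at hd

/-- The Pell-type factorisation of `a ^ 2 - d * b ^ 2 = 1` for odd `a`. -/
theorem exists_pell_factorization {d a b : ℕ} (hd : Squarefree d) (hd4 : d % 4 = 3) (ha : a % 2 = 1)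
    (hb : 0 < b) (h : a ^ 2 = d * b ^ 2 + 1) :
    ∃ m n u v : ℕ, m * n = d ∧ a = 2 * m * u ^ 2 + 1 ∧ a + 1 = 2 * n * v ^ 2 ∧ b = 2 * u * v := by
  obtain ⟨A, rfl⟩ : ∃ A, a = 2 * A + 1 := ⟨a / 2, by omega⟩
  have hb2 : Even b := by
    by_contra hb'
    rw [Nat.not_even_iff_odd] at hb'
    have : Even (d * b ^ 2 + 1) := ((Nat.odd_iff.mpr (by omega)).mul hb'.pow).add_one
    rw [← h] at this
    simp [parity_simps] at this
  obtain ⟨c, rfl⟩ := hb2.two_dvd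
  have hc : c ≠ 0 := by rintro rfl; simp at hb
  have hA : A * (A + 1) = d * c ^ 2 := by nlinarith
  obtain ⟨m, u, hu, hm⟩ := Nat.sq_mul_squarefree A
  obtain ⟨n, v, hv, hn⟩ := Nat.sq_mul_squarefree (A + 1)
  have hco : Nat.Coprime m n := by
    have : Nat.Coprime A (A + 1) := by simp
    exact (this.coprime_dvd_left ⟨u ^ 2, by rw [← hu, mul_comm]⟩).coprime_dvd_right
      ⟨v ^ 2, by rw [← hv, mul_comm]⟩
  have hsq : d * c ^ 2 = (m * n) * (u * v) ^ 2 := by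
    rw [← hA, ← hv, ← hu]; ring
  have hmn : d = m * n :=
    eq_of_squarefree_mul_sq hd ((Nat.squarefree_mul hco).mpr ⟨hm, hn⟩) hc hsq
  refine ⟨m, n, u, v, hmn.symm, by rw [← hu]; ring, by linarith, ?_⟩
  have h0 : 0 < d := by omega
  rw [← hmn] at hsq
  have := Nat.pow_left_injective (n := 2) (by norm_num) (Nat.eq_of_mul_eq_mul_left h0 hsq)
  rw [this]; ring

theorem even_of_sq_sub_mul_sq {d : ℕ} (hd : d % 4 = 3) {P Q N : ℤ}
    (h : P ^ 2 - d * Q ^ 2 = 4 * N) : 2 ∣ P ∧ 2 ∣ Q := by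
  have key : ∀ P Q : ZMod 4, P ^ 2 - 3 * Q ^ 2 = 0 → 2 * P = 0 ∧ 2 * Q = 0 := by decide
  have hd' : (d : ZMod 4) = 3 := by
    rw [← ZMod.natCast_mod, hd]; rfl
  have h4 : (4 : ZMod 4) = 0 := rfl
  have := congrArg (Int.cast : ℤ → ZMod 4) h
  push_cast at this
  rw [hd', h4, zero_mul] at this
  obtain ⟨h1, h2⟩ := key _ _ this
  have h1' := (ZMod.intCast_zmod_eq_zero_iff_dvd (2 * P) 4).mp (by push_cast; exact h1)
  have h2' := (ZMod.intCast_zmod_eq_zero_iff_dvd (2 * Q) 4).mp (by push_cast; exact h2)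
  push_cast at h1' h2'
  omega

theorem even_of_sq_add_unit_mul_sq {d a b : ℕ} (hd : d % 4 = 3) (ha : a % 2 = 0) (hb : b % 2 = 1)
    {p q r t m n : ℤ}
    (h1 : p ^ 2 + d * q ^ 2 + a * (r ^ 2 + d * t ^ 2) + 2 * b * d * r * t = 4 * m)
    (h2 : 2 * p * q + b * (r ^ 2 + d * t ^ 2) + 2 * a * r * t = 4 * n) :
    2 ∣ p ∧ 2 ∣ q ∧ 2 ∣ r ∧ 2 ∣ t := by
  have key : ∀ p q r t : ZMod 4, ∀ a b : Fin 2,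
      p ^ 2 + 3 * q ^ 2 + (2 * a.val : ZMod 4) * (r ^ 2 + 3 * t ^ 2)
        + 2 * (2 * b.val + 1) * 3 * r * t = 0 →
      2 * p * q + (2 * b.val + 1) * (r ^ 2 + 3 * t ^ 2) + 2 * (2 * a.val) * r * t = 0 →
      2 * p = 0 ∧ 2 * q = 0 ∧ 2 * r = 0 ∧ 2 * t = 0 := by decide +kernel
  have hd' : (d : ZMod 4) = 3 := by
    rw [← ZMod.natCast_mod, hd]; rfl
  have h4 : (4 : ZMod 4) = 0 := rfl
  obtain ⟨a', ha'⟩ : ∃ a' : Fin 2, (a : ZMod 4) = 2 * a'.val := by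
    have : a % 4 = 0 ∨ a % 4 = 2 := by omega
    rw [← ZMod.natCast_mod a 4]
    rcases this with h | h <;> rw [h]
    · exact ⟨0, by simp⟩
    · exact ⟨1, by simp⟩
  obtain ⟨b', hb'⟩ : ∃ b' : Fin 2, (b : ZMod 4) = 2 * b'.val + 1 := by
    have : b % 4 = 1 ∨ b % 4 = 3 := by omega
    rw [← ZMod.natCast_mod b 4]
    rcases this with h | h <;> rw [h]
    · exact ⟨0, by simp⟩
    · exact ⟨1, by simp; decide⟩
  have e1 := congrArg (Int.cast : ℤ → ZMod 4) h1
  have e2 := congrArg (Int.cast : ℤ → ZMod 4) h2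
  push_cast at e1 e2
  rw [hd', h4, zero_mul, ha', hb'] at e1 e2
  have h := key _ _ _ _ a' b' e1 e2
  have dvd (z : ℤ) (hz : 2 * (z : ZMod 4) = 0) : 2 ∣ z := by
    have := (ZMod.intCast_zmod_eq_zero_iff_dvd (2 * z) 4).mp (by push_cast; exact hz)
    push_cast at this
    omega
  exact ⟨dvd _ h.1, dvd _ h.2.1, dvd _ h.2.2.1, dvd _ h.2.2.2⟩

open Polynomial in
theorem aeval_derivative_mem_differentIdeal_of_aeval_eq_zero {K L : Type*} [Field K] [Field L]
    [NumberField K] [NumberField L] [Algebra K L] (x : 𝓞 L)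
    (hx : Algebra.adjoin K {algebraMap (𝓞 L) L x} = ⊤) {f : (𝓞 K)[X]} (hf : aeval x f = 0) :
    aeval x (derivative f) ∈ differentIdeal (𝓞 K) (𝓞 L) := by
  obtain ⟨g, rfl⟩ := minpoly.isIntegrallyClosed_dvd (Algebra.IsIntegral.isIntegral x) hf
  have := Ideal.mul_mem_left _ (aeval x g) (aeval_derivative_mem_differentIdeal (𝓞 K) K L x hx)
  simpa [derivative_mul, mul_comm] using this

section RealQuadratic

variable {K : Type} [Field K] {d : ℕ} {r : 𝓞 K}

/-- The dyadic prime contains `p + q √d` exactly when `p` and `q` have the same parity. -/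
theorem intCast_add_mul_mem_iff (hd4 : d % 4 = 3) (hr : r ^ 2 = d)
    {I : Ideal (𝓞 K)} (hI : I.IsPrime) (h2 : (2 : 𝓞 K) ∈ I) (p q : ℤ) :
    (p : 𝓞 K) + q * r ∈ I ↔ 2 ∣ p - q := by
  have hr1 : 1 + r ∈ I := by
    refine hI.mem_of_pow_mem 2 ?_
    obtain ⟨k, hk⟩ : ∃ k, d = 2 * k + 1 := ⟨d / 2, by omega⟩
    have : (1 + r) ^ 2 = (1 + k + r) * 2 := by
      rw [hk] at hr; push_cast at hr; linear_combination hr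
    rw [this]
    exact I.mul_mem_left _ h2
  have hdec : (p : 𝓞 K) + q * r = ((p - q : ℤ) : 𝓞 K) + q * (1 + r) := by push_cast; ring
  rw [hdec, I.add_mem_iff_left (I.mul_mem_left _ hr1)]
  generalize p - q = z
  constructor
  · intro hz
    by_contra hodd
    obtain ⟨k, rfl⟩ : ∃ k, z = 2 * k + 1 := ⟨z / 2, by omega⟩
    refine hI.ne_top (I.eq_top_iff_one.mpr ?_)
    have : (1 : 𝓞 K) = ((2 * k + 1 : ℤ) : 𝓞 K) - k * 2 := by push_cast; ring
    rw [this]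
    exact I.sub_mem hz (I.mul_mem_left _ h2)
  · rintro ⟨k, rfl⟩
    push_cast
    exact I.mul_mem_right _ h2

variable {L : Type} [Field L] [Algebra K L] {a b : ℕ} {s : 𝓞 L}

theorem map_eq_sq_of_two_mem (hd4 : d % 4 = 3) (hr : r ^ 2 = d)
    (hspan : ∀ x : 𝓞 K, ∃ p q : ℤ, x = p + q * r) (ha : a % 2 = 0) (hb : b % 2 = 1)
    (hs : s ^ 2 = algebraMap (𝓞 K) (𝓞 L) (-(a + b * r)))
    (hspanL : ∀ x : 𝓞 L, ∃ u v : 𝓞 K,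
      x = algebraMap (𝓞 K) (𝓞 L) u + algebraMap (𝓞 K) (𝓞 L) v * s)
    {I : Ideal (𝓞 K)} (hI : I.IsPrime) (h2 : (2 : 𝓞 K) ∈ I) :
    ∃ P : Ideal (𝓞 L), P.IsPrime ∧ I.map (algebraMap (𝓞 K) (𝓞 L)) = P ^ 2 := by
  set φ := algebraMap (𝓞 K) (𝓞 L) with hφ
  set J := I.map φ with hJ
  have hmem := intCast_add_mul_mem_iff hd4 hr hI h2
  have hIJ {x : 𝓞 K} (hx : x ∈ I) : φ x ∈ J := Ideal.mem_map_of_mem φ hx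
  have hJtop : J ≠ ⊤ := by
    rw [hJ, Ne, Ideal.map_eq_top_iff φ (FaithfulSMul.algebraMap_injective _ _)
      (algebraMap_isIntegral_iff.mpr inferInstance)]
    exact hI.ne_top
  have hr1 : 1 + r ∈ I := by simpa using (hmem 1 1).mpr (by norm_num)
  have hε1 : 1 - (a + b * r) ∈ I := by
    have := (hmem (1 - a) (-b)).mpr (by omega)
    push_cast at this
    convert this using 1
    ring
  have h2J : (2 : 𝓞 L) ∈ J := map_ofNat φ 2 ▸ hIJ h2
  have hsq : (1 + s) ^ 2 = φ (1 - (a + b * r)) + 2 * s := by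
    rw [map_sub, map_one, sub_eq_add_neg, ← map_neg, ← hs]; ring
  have hsqJ : (1 + s) ^ 2 ∈ J := by
    rw [hsq]; exact J.add_mem (hIJ hε1) (J.mul_mem_right _ h2J)
  set P := J ⊔ Ideal.span {1 + s} with hP
  have hJP : J ≤ P := le_sup_left
  have hsP : 1 + s ∈ P := Ideal.mem_sup_right (Ideal.mem_span_singleton_self _)
  have h2sq : (2 : 𝓞 L) ∈ P ^ 2 := by
    obtain ⟨k, hk⟩ : ∃ k, d = 4 * k + 3 := ⟨d / 4, by omega⟩
    have h1 : φ (1 + r) ^ 2 ∈ P ^ 2 := Ideal.pow_mem_pow (hJP (hIJ hr1)) 2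
    have h3 : (2 : 𝓞 L) ^ 2 ∈ P ^ 2 := Ideal.pow_mem_pow (hJP h2J) 2
    have hr' : φ r ^ 2 = 4 * k + 3 := by
      rw [← map_pow, hr, hk, map_natCast]; push_cast; ring
    have : (2 : 𝓞 L) = φ r * φ (1 + r) ^ 2 - (1 + φ r * (k + 1) + 2 * k) * 2 ^ 2 := by
      rw [map_add, map_one]
      linear_combination -(φ r + 2) * hr'
    rw [this]
    exact (P ^ 2).sub_mem ((P ^ 2).mul_mem_left _ h1) ((P ^ 2).mul_mem_left _ h3)
  have hεsq : φ (1 - (a + b * r)) ∈ P ^ 2 := by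
    rw [← add_sub_cancel_right (φ (1 - (a + b * r))) (2 * s), ← hsq]
    exact (P ^ 2).sub_mem (Ideal.pow_mem_pow hsP 2) ((P ^ 2).mul_mem_right _ h2sq)
  have hrsq : φ (1 + r) ∈ P ^ 2 := by
    obtain ⟨a', rfl⟩ : ∃ a', a = 2 * a' := ⟨a / 2, by omega⟩
    obtain ⟨b', rfl⟩ : ∃ b', b = 2 * b' + 1 := ⟨b / 2, by omega⟩
    have : φ (1 + r) = φ (1 - ((2 * a' : ℕ) + (2 * b' + 1 : ℕ) * r))
        + 2 * φ (a' + (b' + 1) * r) := by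
      rw [← map_ofNat φ 2, ← map_mul, ← map_add]
      congr 1
      push_cast
      ring
    rw [this]
    exact (P ^ 2).add_mem hεsq ((P ^ 2).mul_mem_right _ h2sq)
  have hPJ : J = P ^ 2 := by
    refine le_antisymm (Ideal.map_le_iff_le_comap.mpr fun x hx => ?_) ?_
    · obtain ⟨p, q, rfl⟩ := hspan x
      obtain ⟨k, hk⟩ := (hmem p q).mp hx
      obtain rfl : p = q + 2 * k := by omega
      rw [Ideal.mem_comap]
      have : φ ((q + 2 * k : ℤ) + q * r) = q * φ (1 + r) + k * 2 := by
        simp only [map_add, map_mul, map_intCast, map_one]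
        push_cast
        ring
      rw [this]
      exact (P ^ 2).add_mem ((P ^ 2).mul_mem_left _ hrsq) ((P ^ 2).mul_mem_left _ h2sq)
    · rw [hP, sq, Ideal.sup_mul, Ideal.mul_sup (Ideal.span _),
        Ideal.span_singleton_mul_span_singleton]
      refine sup_le Ideal.mul_le_left (sup_le Ideal.mul_le_right ?_)
      rw [Ideal.span_singleton_le_iff_mem, ← sq]
      exact hsqJ
  have hPtop : P ≠ ⊤ := fun h => hJtop (by rw [hPJ, h, Ideal.top_pow])
  have h01 (x : 𝓞 L) : x ∈ P ∨ x - 1 ∈ P := by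
    obtain ⟨u, v, rfl⟩ := hspanL x
    obtain ⟨p, q, hpq⟩ := hspan (u - v)
    have hdec : φ u + φ v * s = φ (u - v) + φ v * (1 + s) := by rw [map_sub]; ring
    have hvP : φ v * (1 + s) ∈ P := P.mul_mem_left _ hsP
    by_cases h : 2 ∣ p - q
    · left
      rw [hdec, hpq]
      exact P.add_mem (hJP (hIJ ((hmem p q).mpr h))) hvP
    · right
      have h1 : u - v - 1 ∈ I := by
        have : u - v - 1 = ((p - 1 : ℤ) : 𝓞 K) + q * r := by rw [hpq]; push_cast; ring
        rw [this, hmem]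
        omega
      have : φ u + φ v * s - 1 = φ (u - v - 1) + φ v * (1 + s) := by
        rw [hdec, map_sub φ (u - v), map_one]; ring
      rw [this]
      exact P.add_mem (hJP (hIJ h1)) hvP
  refine ⟨P, ⟨hPtop, fun {x y} hxy => ?_⟩, hPJ⟩
  by_contra! h
  have hx := (h01 x).resolve_left h.1
  have hy := (h01 y).resolve_left h.2
  refine hPtop (P.eq_top_iff_one.mpr ?_)
  have : 1 = x * y - (x - 1) * y - (y - 1) := by ring
  rw [this]
  exact P.sub_mem (P.sub_mem hxy (P.mul_mem_right _ hx)) hy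

variable [NumberField K]

theorem intCast_add_mul_eq_zero_iff (hd : ¬ IsSquare d) (hr : r ^ 2 = d) {p q : ℤ} :
    (p : 𝓞 K) + q * r = 0 ↔ p = 0 ∧ q = 0 := by
  refine ⟨fun h => ?_, by rintro ⟨rfl, rfl⟩; simp⟩
  have h1 : p ^ 2 = q ^ 2 * d := by
    have : (p : 𝓞 K) ^ 2 = q ^ 2 * d := by
      rw [← hr]; linear_combination (p - q * r) * h
    exact_mod_cast this
  have hq : q = 0 := by
    by_contra hq
    refine hd (Rat.isSquare_natCast_iff.mp ⟨(p / q : ℚ), ?_⟩)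
    have hq' : (q : ℚ) ≠ 0 := by exact_mod_cast hq
    field_simp
    have : (p : ℚ) ^ 2 = q ^ 2 * d := by exact_mod_cast h1
    linarith
  subst hq
  simpa using h1

theorem intCast_add_mul_inj (hd : ¬ IsSquare d) (hr : r ^ 2 = d) {p q p' q' : ℤ}
    (h : (p : 𝓞 K) + q * r = p' + q' * r) : p = p' ∧ q = q' := by
  have h0 : ((p - p' : ℤ) : 𝓞 K) + (q - q' : ℤ) * r = 0 := by
    push_cast; linear_combination h
  have := (intCast_add_mul_eq_zero_iff hd hr).mp h0
  omega

theorem exists_eq_intCast_add_mul (hdsf : Squarefree d) (hd4 : d % 4 = 3) (hr : r ^ 2 = d)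
    (hgen : Algebra.adjoin ℚ {algebraMap (𝓞 K) K r} = ⊤) (x : 𝓞 K) :
    ∃ p q : ℤ, x = p + q * r := by
  have hr' : (algebraMap (𝓞 K) K r) ^ 2 = algebraMap ℚ K d := by
    rw [← map_pow, hr]; simp
  obtain ⟨u, v, hx⟩ := exists_eq_add_mul_of_adjoin_eq_top hr' hgen (algebraMap (𝓞 K) K x)
  have hxint : IsIntegral ℤ (algebraMap ℚ K u + algebraMap ℚ K v * algebraMap (𝓞 K) K r) :=
    hx ▸ RingOfIntegers.isIntegral_coe x
  obtain ⟨P, N, hP, hN⟩ := exists_trace_norm_of_isIntegral ℤ hr'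
    (by rw [Rat.isSquare_natCast_iff]; exact not_isSquare_of_mod_four_eq_three hd4) hxint
  simp only [algebraMap_int_eq, eq_intCast] at hP hN
  obtain ⟨Q, hQ⟩ : ∃ Q : ℤ, 2 * v = Q :=
    exists_int_of_sq_mul_squarefree hdsf (M := P ^ 2 - 4 * N) (by
      push_cast; rw [hP, hN]; ring)
  have hPQ : P ^ 2 - d * Q ^ 2 = 4 * N := by
    have : (P : ℚ) ^ 2 - d * Q ^ 2 = 4 * N := by rw [hP, hN, ← hQ]; ring
    exact_mod_cast this
  obtain ⟨⟨p, rfl⟩, ⟨q, rfl⟩⟩ := even_of_sq_sub_mul_sq hd4 hPQ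
  refine ⟨p, q, RingOfIntegers.ext ?_⟩
  have hu : u = p := by push_cast at hP; linarith
  have hv : v = q := by push_cast at hQ; linarith
  change algebraMap (𝓞 K) K x = algebraMap (𝓞 K) K _
  rw [hx, hu, hv]
  simp

theorem norm_eq_one_of_isUnit (hdsf : Squarefree d) (hd4 : d % 4 = 3) (hr : r ^ 2 = d)
    (hgen : Algebra.adjoin ℚ {algebraMap (𝓞 K) K r} = ⊤) {a b : ℕ}
    (h : IsUnit ((a : 𝓞 K) + b * r)) : a ^ 2 = d * b ^ 2 + 1 := by
  obtain ⟨y, hy⟩ := h.exists_right_inv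
  obtain ⟨p, q, rfl⟩ := exists_eq_intCast_add_mul hdsf hd4 hr hgen y
  have h1 := intCast_add_mul_inj (K := K) (not_isSquare_of_mod_four_eq_three hd4) hr
    (p := a * p + d * b * q) (q := a * q + b * p) (p' := 1) (q' := 0) (by
      push_cast; linear_combination hy - b * q * hr)
  have h2 : ((a : ℤ) ^ 2 - d * b ^ 2) * (p ^ 2 - d * q ^ 2) = 1 := by
    linear_combination (a * p + d * b * q + 1) * h1.1 - d * (a * q + b * p) * h1.2
  rcases Int.isUnit_iff.mp (IsUnit.of_mul_eq_one _ h2) with h3 | h3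
  · zify; linarith
  · exfalso
    have key : ∀ x y : ZMod 4, x ^ 2 - 3 * y ^ 2 ≠ -1 := by decide
    have hd' : (d : ZMod 4) = 3 := by rw [← ZMod.natCast_mod, hd4]; rfl
    have := congrArg (Int.cast : ℤ → ZMod 4) h3
    push_cast at this
    rw [hd'] at this
    exact key _ _ this

/-- If `ε = a + b √d` is a unit with `a` even and `b` odd and `s ^ 2 = -ε`, then every integer of
`L = K(s)` lies in `𝓞 K ⊕ 𝓞 K · s`. -/
theorem exists_eq_algebraMap_add_mul_sqrt (hdsf : Squarefree d) (hd4 : d % 4 = 3) (hr : r ^ 2 = d)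
    (hgen : Algebra.adjoin ℚ {algebraMap (𝓞 K) K r} = ⊤) (ha : a % 2 = 0) (hb : b % 2 = 1)
    (hunit : IsUnit ((a : 𝓞 K) + b * r))
    (hs : s ^ 2 = algebraMap (𝓞 K) (𝓞 L) (-(a + b * r)))
    (hgenL : Algebra.adjoin K {algebraMap (𝓞 L) L s} = ⊤)
    (hns : ¬ IsSquare (algebraMap (𝓞 K) K (-(a + b * r)))) (x : 𝓞 L) :
    ∃ u v : 𝓞 K, x = algebraMap (𝓞 K) (𝓞 L) u + algebraMap (𝓞 K) (𝓞 L) v * s := by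
  have hs' : (algebraMap (𝓞 L) L s) ^ 2 =
      algebraMap K L (algebraMap (𝓞 K) K (-(a + b * r))) := by
    rw [← map_pow, hs, ← IsScalarTower.algebraMap_apply, ← IsScalarTower.algebraMap_apply]
  obtain ⟨u, v, hx⟩ := exists_eq_add_mul_of_adjoin_eq_top hs' hgenL (algebraMap (𝓞 L) L x)
  have hxint : IsIntegral (𝓞 K) (algebraMap K L u + algebraMap K L v * algebraMap (𝓞 L) L s) :=
    hx ▸ (RingOfIntegers.isIntegral_coe x).tower_top
  obtain ⟨T, N, hT, hN⟩ := exists_trace_norm_of_isIntegral (𝓞 K) hs' hns hxint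
  obtain ⟨e, he⟩ := hunit.exists_right_inv
  have he' := congrArg (algebraMap (𝓞 K) K) he
  obtain ⟨V, hV⟩ : ∃ V : 𝓞 K, algebraMap (𝓞 K) K V = 2 * v := by
    refine IsIntegrallyClosed.isIntegral_iff.mp (IsIntegral.of_pow (n := 2) (by norm_num) ?_)
    refine IsIntegrallyClosed.isIntegral_iff.mpr ⟨e * (4 * N - T ^ 2), ?_⟩
    simp only [map_mul, map_sub, map_pow, map_ofNat, hT, hN, map_add, map_neg, map_natCast,
      map_one] at he' ⊢
    linear_combination 4 * v ^ 2 * he'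
  have hTV : T ^ 2 + (a + b * r) * V ^ 2 = 4 * N := by
    refine RingOfIntegers.ext ?_
    simp only [map_mul, map_pow, map_ofNat, hT, hN, hV, map_add, map_neg, map_natCast]
    ring
  obtain ⟨p, q, rfl⟩ := exists_eq_intCast_add_mul hdsf hd4 hr hgen T
  obtain ⟨p', q', rfl⟩ := exists_eq_intCast_add_mul hdsf hd4 hr hgen V
  obtain ⟨m, n, rfl⟩ := exists_eq_intCast_add_mul hdsf hd4 hr hgen N
  have h := intCast_add_mul_inj (K := K) (not_isSquare_of_mod_four_eq_three hd4) hr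
    (p := p ^ 2 + d * q ^ 2 + a * (p' ^ 2 + d * q' ^ 2) + 2 * b * d * p' * q')
    (q := 2 * p * q + b * (p' ^ 2 + d * q' ^ 2) + 2 * a * p' * q') (p' := 4 * m) (q' := 4 * n) (by
      push_cast
      linear_combination hTV - (q ^ 2 + a * q' ^ 2 + 2 * b * p' * q' + b * q' ^ 2 * r) * hr)
  obtain ⟨⟨p, rfl⟩, ⟨q, rfl⟩, ⟨p', rfl⟩, ⟨q', rfl⟩⟩ :=
    even_of_sq_add_unit_mul_sq hd4 ha hb h.1 h.2
  have hu : algebraMap (𝓞 K) K (p + q * r) = u := by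
    have h2 : (2 : K) ≠ 0 := two_ne_zero
    refine mul_left_cancel₀ h2 (hT ▸ ?_)
    simp only [map_add, map_mul, map_intCast]
    push_cast
    ring
  have hv : algebraMap (𝓞 K) K (p' + q' * r) = v := by
    have h2 : (2 : K) ≠ 0 := two_ne_zero
    refine mul_left_cancel₀ h2 (hV ▸ ?_)
    simp only [map_add, map_mul, map_intCast]
    push_cast
    ring
  refine ⟨p + q * r, p' + q' * r, RingOfIntegers.ext ?_⟩
  change algebraMap (𝓞 L) L x = algebraMap (𝓞 L) L _
  rw [hx, ← hu, ← hv, map_add (algebraMap (𝓞 L) L), map_mul (algebraMap (𝓞 L) L)]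
  simp only [← IsScalarTower.algebraMap_apply]

end RealQuadratic

section Odd

variable {K L : Type} [Field K] [NumberField K] [Field L] [NumberField L] [Algebra K L]

open Polynomial in
theorem mem_differentIdeal_of_sq_eq_neg {m : ℕ} (hm : m % 4 = 3) {t : 𝓞 L} (ht : t ^ 2 = -m)
    (hgen : Algebra.adjoin K {algebraMap (𝓞 L) L t} = ⊤) :
    t ∈ differentIdeal (𝓞 K) (𝓞 L) := by
  obtain ⟨k, hk⟩ : ∃ k, m + 1 = 4 * k := ⟨(m + 1) / 4, by omega⟩
  have hkL : (m : L) + 1 = 4 * k := by exact_mod_cast hk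
  have htL : (algebraMap (𝓞 L) L t) ^ 2 = -m := by
    rw [← map_pow, ht, map_neg, map_natCast]
  have hroot : ((1 + algebraMap (𝓞 L) L t) / 2) ^ 2 - (1 + algebraMap (𝓞 L) L t) / 2 + k = 0 := by
    linear_combination htL / 4 - hkL / 4
  have hint : IsIntegral ℤ ((1 + algebraMap (𝓞 L) L t) / 2) := by
    refine ⟨X ^ 2 - X + C (k : ℤ), by monicity!, ?_⟩
    simpa [eval₂_add, eval₂_sub] using hroot
  obtain ⟨x, hx⟩ : ∃ x : 𝓞 L, algebraMap (𝓞 L) L x = (1 + algebraMap (𝓞 L) L t) / 2 :=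
    ⟨⟨_, hint⟩, rfl⟩
  have htx : t = 2 * x - 1 := by
    refine RingOfIntegers.ext ?_
    change algebraMap (𝓞 L) L t = algebraMap (𝓞 L) L _
    rw [map_sub, map_mul, hx, map_ofNat, map_one]
    ring
  have hxgen : Algebra.adjoin K {algebraMap (𝓞 L) L x} = ⊤ := by
    rw [eq_top_iff, ← hgen]
    refine Algebra.adjoin_singleton_le ?_
    rw [htx, map_sub, map_mul, map_ofNat, map_one, two_mul]
    have := Algebra.self_mem_adjoin_singleton K (algebraMap (𝓞 L) L x)
    exact sub_mem (add_mem this this) (one_mem _)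
  have hxroot : aeval x (X ^ 2 - X + C (k : 𝓞 K)) = 0 := by
    refine RingOfIntegers.ext ?_
    change algebraMap (𝓞 L) L _ = algebraMap (𝓞 L) L _
    rw [map_zero, ← hroot, ← hx]
    simp
  have := aeval_derivative_mem_differentIdeal_of_aeval_eq_zero x hxgen hxroot
  simp at this
  rwa [one_add_one_eq_two, ← htx] at this

open Polynomial in
theorem differentIdeal_eq_top_of_sq_mul_eq_neg {m : ℕ} (hm : m % 4 = 3) {s : 𝓞 L} {e w : 𝓞 K}
    (hs : s ^ 2 = algebraMap (𝓞 K) (𝓞 L) e) (he : IsUnit e)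
    (hgen : Algebra.adjoin K {algebraMap (𝓞 L) L s} = ⊤) (hw : e * w ^ 2 = -m) :
    differentIdeal (𝓞 K) (𝓞 L) = ⊤ := by
  set D := differentIdeal (𝓞 K) (𝓞 L)
  set φ := algebraMap (𝓞 K) (𝓞 L) with hφ
  have ht : (s * φ w) ^ 2 = -m := by
    rw [mul_pow, hs, ← map_pow, ← map_mul, hw, map_neg, map_natCast]
  have hw0 : algebraMap (𝓞 K) K w ≠ 0 := by
    rw [Ne, RingOfIntegers.coe_eq_zero_iff]
    rintro rfl
    have : (m : 𝓞 K) = 0 := by linear_combination hw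
    have : m = 0 := by exact_mod_cast this
    omega
  have htgen : Algebra.adjoin K {algebraMap (𝓞 L) L (s * φ w)} = ⊤ := by
    rw [eq_top_iff, ← hgen]
    refine Algebra.adjoin_singleton_le ?_
    have : algebraMap (𝓞 L) L s =
        (algebraMap (𝓞 K) K w)⁻¹ • algebraMap (𝓞 L) L (s * φ w) := by
      have h0 : algebraMap K L (algebraMap (𝓞 K) K w) ≠ 0 := by simpa using hw0
      rw [Algebra.smul_def, map_mul, hφ, ← IsScalarTower.algebraMap_apply, map_inv₀,
        IsScalarTower.algebraMap_apply (𝓞 K) K L, mul_comm (algebraMap (𝓞 L) L s),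
        inv_mul_cancel_left₀ h0]
    rw [this]
    exact Subalgebra.smul_mem _ (Algebra.self_mem_adjoin_singleton K _) _
  have hmD : (m : 𝓞 L) ∈ D := by
    rw [← neg_neg (m : 𝓞 L), ← ht, sq]
    exact D.neg_mem (D.mul_mem_left _ (mem_differentIdeal_of_sq_eq_neg hm ht htgen))
  have h2s : 2 * s ∈ D := by
    have hroot : aeval s (X ^ 2 - C e) = 0 := by simp [hs, hφ]
    have := aeval_derivative_mem_differentIdeal_of_aeval_eq_zero s hgen hroot
    simp at this
    rwa [one_add_one_eq_two] at this
  have hsunit : IsUnit s := by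
    rw [← isUnit_pow_iff (n := 2) two_ne_zero, hs]
    exact he.map φ
  have h2 : (2 : 𝓞 L) ∈ D := (D.mul_unit_mem_iff_mem hsunit).mp h2s
  obtain ⟨k, rfl⟩ : ∃ k, m = 2 * k + 1 := ⟨m / 2, by omega⟩
  rw [D.eq_top_iff_one]
  have : (1 : 𝓞 L) = (2 * k + 1 : ℕ) - k * 2 := by push_cast; ring
  rw [this]
  exact D.sub_mem hmD (D.mul_mem_left _ h2)

theorem differentIdeal_eq_top_of_odd {d a b : ℕ} {r : 𝓞 K} {s : 𝓞 L} (hdsf : Squarefree d)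
    (hd4 : d % 4 = 3) (hr : r ^ 2 = d) (ha : a % 2 = 1) (hb : 0 < b)
    (hnorm : a ^ 2 = d * b ^ 2 + 1)
    (hs : s ^ 2 = algebraMap (𝓞 K) (𝓞 L) (-(a + b * r)))
    (hgenL : Algebra.adjoin K {algebraMap (𝓞 L) L s} = ⊤) :
    differentIdeal (𝓞 K) (𝓞 L) = ⊤ := by
  obtain ⟨m, n, u, v, rfl, ham, han, rfl⟩ := exists_pell_factorization hdsf hd4 ha hb hnorm
  push_cast at hr
  have hn : (a : 𝓞 K) ^ 2 = m * n * (2 * u * v) ^ 2 + 1 := by exact_mod_cast hnorm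
  have hsum : (a : 𝓞 K) = m * u ^ 2 + n * v ^ 2 := by
    have : a = m * u ^ 2 + n * v ^ 2 := by linarith
    exact_mod_cast this
  have hunit : IsUnit (-(a + (2 * u * v : ℕ) * r : 𝓞 K)) := by
    refine (IsUnit.of_mul_eq_one (a - (2 * u * v : ℕ) * r) ?_).neg
    push_cast
    linear_combination hn - (2 * u * v) ^ 2 * hr
  have hmn : m % 4 = 3 ∨ n % 4 = 3 := by
    have h1 : m % 4 < 4 := Nat.mod_lt _ (by norm_num)
    have h2 : n % 4 < 4 := Nat.mod_lt _ (by norm_num)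
    rw [Nat.mul_mod] at hd4
    interval_cases m % 4 <;> interval_cases n % 4 <;> simp_all
  rcases hmn with h | h
  · refine differentIdeal_eq_top_of_sq_mul_eq_neg (w := m * u - v * r) h hs hunit hgenL ?_
    have : (m * u - v * r : 𝓞 K) ^ 2 = m * (a - 2 * u * v * r) := by
      linear_combination (v : 𝓞 K) ^ 2 * hr - m * hsum
    rw [this]
    push_cast
    linear_combination -m * hn + m * (2 * u * v) ^ 2 * hr
  · refine differentIdeal_eq_top_of_sq_mul_eq_neg (w := n * v - u * r) h hs hunit hgenL ?_
    have : (n * v - u * r : 𝓞 K) ^ 2 = n * (a - 2 * u * v * r) := by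
      linear_combination (u : 𝓞 K) ^ 2 * hr - n * hsum
    rw [this]
    push_cast
    linear_combination -n * hn + n * (2 * u * v) ^ 2 * hr

theorem not_exists_map_eq_sq_of_differentIdeal_eq_top
    (hD : differentIdeal (𝓞 K) (𝓞 L) = ⊤) {I : Ideal (𝓞 K)} (hI : I.IsPrime) (hI0 : I ≠ ⊥) :
    ¬ ∃ P : Ideal (𝓞 L), P.IsPrime ∧ I.map (algebraMap (𝓞 K) (𝓞 L)) = P ^ 2 := by
  rintro ⟨P, hP, hIP⟩
  have := hI.isMaximal hI0
  have h := pow_sub_one_dvd_differentIdeal (𝓞 K) P 2 hI0 hIP.symm.dvd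
  rw [hD, Nat.add_one_sub_one, pow_one, Ideal.dvd_iff_le, top_le_iff] at h
  exact hP.ne_top h

end Odd

/-- **Ramification of `L = F(√−ε)` over `F = ℚ(√d)`, `d ≡ 3 (mod 4)`, at the dyadic
prime.** -/
theorem ramification_of_sqrt_neg_fundamentalUnit
    (d : ℕ) (hd6 : 6 ≤ d) (hdsf : Squarefree d) (hd4 : d % 4 = 3)
    (sqrtd : F) (hsqrtd : sqrtd ^ 2 = (d : F))
    (hgen : Algebra.adjoin ℚ {sqrtd} = ⊤)
    (σ₀ : F →+* ℝ) (hσ₀ : 0 < σ₀ sqrtd)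
    -- `ε` is the fundamental unit of `F`: the smallest unit greater than `1`
    (ε : (𝓞 F)ˣ) (hε : 1 < σ₀ (algebraMap (𝓞 F) F ↑ε))
    (hεfund : ∀ u : (𝓞 F)ˣ, 1 < σ₀ (algebraMap (𝓞 F) F ↑u) →
      σ₀ (algebraMap (𝓞 F) F ↑ε) ≤ σ₀ (algebraMap (𝓞 F) F ↑u))
    -- write `ε = a + b √d` with positive integers `a`, `b`
    (a b : ℕ) (hapos : 0 < a) (hbpos : 0 < b)
    (hεab : algebraMap (𝓞 F) F ↑ε = (a : F) + (b : F) * sqrtd)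
    -- `L = F(√−ε)`
    (L : Type) [Field L] [NumberField L] [Algebra F L]
    (s : L) (hs : s ^ 2 = algebraMap F L (-(algebraMap (𝓞 F) F ↑ε)))
    (hgenL : Algebra.adjoin F {s} = ⊤) :
    -- if `a` is even, `L/F` is ramified at the unique prime `𝔭` of `O_F` above `2`
    -- and `O_L = O_F[√−ε] = O_F ⊕ O_F·√−ε`
    (a % 2 = 0 →
      (∀ 𝔭 : Ideal (𝓞 F), 𝔭.IsPrime → (2 : 𝓞 F) ∈ 𝔭 →
        ∃ 𝔓 : Ideal (𝓞 L), 𝔓.IsPrime ∧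
          Ideal.map (algebraMap (𝓞 F) (𝓞 L)) 𝔭 = 𝔓 ^ 2) ∧
      (∀ x : 𝓞 L, ∃ u v : 𝓞 F,
        algebraMap (𝓞 L) L x =
          algebraMap F L (algebraMap (𝓞 F) F u) +
            algebraMap F L (algebraMap (𝓞 F) F v) * s)) ∧
    -- if `a` is odd, `L/F` is unramified at every finite prime of `F`
    (a % 2 = 1 →
      ∀ 𝔭 : Ideal (𝓞 F), 𝔭.IsPrime → 𝔭 ≠ ⊥ →
        ¬∃ 𝔓 : Ideal (𝓞 L), 𝔓.IsPrime ∧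
          Ideal.map (algebraMap (𝓞 F) (𝓞 L)) 𝔭 = 𝔓 ^ 2) := by
  obtain ⟨r, rfl⟩ : ∃ r : 𝓞 F, algebraMap (𝓞 F) F r = sqrtd :=
    ⟨⟨sqrtd, IsIntegral.of_pow two_pos (hsqrtd ▸ isIntegral_natCast d)⟩, rfl⟩
  have hr : r ^ 2 = d := by
    refine RingOfIntegers.ext ?_
    change algebraMap (𝓞 F) F _ = algebraMap (𝓞 F) F _
    rw [map_pow, hsqrtd, map_natCast]
  have hεr : (ε : 𝓞 F) = a + b * r := by
    refine RingOfIntegers.ext ?_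
    change algebraMap (𝓞 F) F _ = algebraMap (𝓞 F) F _
    rw [hεab]
    simp
  have hunit : IsUnit ((a : 𝓞 F) + b * r) := hεr ▸ ε.isUnit
  have hns : ¬ IsSquare (algebraMap (𝓞 F) F (-(a + b * r))) := by
    rintro ⟨y, hy⟩
    have h := congrArg σ₀ hy
    rw [← hεr, map_neg, map_neg, map_mul] at h
    nlinarith [mul_self_nonneg (σ₀ y)]
  rw [← map_neg, hεr] at hs
  obtain ⟨s, rfl⟩ : ∃ s' : 𝓞 L, algebraMap (𝓞 L) L s' = s := by
    refine ⟨⟨s, IsIntegral.of_pow two_pos ?_⟩, rfl⟩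
    rw [hs]
    exact (RingOfIntegers.isIntegral_coe _).algebraMap
  replace hs : s ^ 2 = algebraMap (𝓞 F) (𝓞 L) (-(a + b * r)) := by
    refine RingOfIntegers.ext ?_
    change algebraMap (𝓞 L) L _ = algebraMap (𝓞 L) L _
    rw [map_pow, hs, ← IsScalarTower.algebraMap_apply, ← IsScalarTower.algebraMap_apply]
  have hnorm := norm_eq_one_of_isUnit hdsf hd4 hr hgen hunit
  refine ⟨fun ha => ?_, fun ha 𝔭 h𝔭 h𝔭0 => not_exists_map_eq_sq_of_differentIdeal_eq_top
    (differentIdeal_eq_top_of_odd hdsf hd4 hr ha hbpos hnorm hs hgenL) h𝔭 h𝔭0⟩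
  have hb : b % 2 = 1 := by
    by_contra hb
    have h1 : Even (d * b ^ 2) :=
      ((Nat.even_iff.mpr (by omega)).pow_of_ne_zero two_ne_zero).mul_left d
    have h2 : Even (a ^ 2) := (Nat.even_iff.mpr ha).pow_of_ne_zero two_ne_zero
    rw [hnorm] at h2
    exact Nat.not_even_iff_odd.mpr h1.add_one h2
  have hspanL := exists_eq_algebraMap_add_mul_sqrt hdsf hd4 hr hgen ha hb hunit hs hgenL hns
  refine ⟨fun 𝔭 h𝔭 h2 => map_eq_sq_of_two_mem hd4 hr
    (exists_eq_intCast_add_mul hdsf hd4 hr hgen) ha hb hs hspanL h𝔭 h2, fun x => ?_⟩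
  obtain ⟨u, v, rfl⟩ := hspanL x
  refine ⟨u, v, ?_⟩
  rw [map_add, map_mul]
  simp only [← IsScalarTower.algebraMap_apply]

end QuatPaper
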